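/- Let f be a non wandering positive twist map of the closed annulus A = 𝕋 × [0,1] such that no essential simple loop meeting each vertical segment {x}×[0,1] in exactly one point is f-invariant, except C₀ and C₁. Let X₀ ⊆ A be a continuum with X₀ ⊆ f(X₀), strictly containing C₀ and disjoint from C₁. Then ⋂_{n≥0} f^{−n}(X₀) = C₀ and C₁ is contained in the closure of ⋃_{n≥0} fⁿ(X₀). -/

import Mathlib

open Set Filter Topology MeasureTheory

noncomputable section

/-- The circle `𝕋 = ℝ/ℤ`. -/
abbrev 𝕋 : Type := AddCircle (1 : ℝ)

/-- The closed annulus `A = 𝕋 × [0,1]`. -/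
abbrev Ann : Type := 𝕋 × ↥(Set.Icc (0:ℝ) 1)

/-- The universal cover `Ã = ℝ × [0,1]`. -/
abbrev StripA : Type := ℝ × ↥(Set.Icc (0:ℝ) 1)

/-- The covering projection `π : Ã → A`. -/
def annProj : StripA → Ann := fun z => ((z.1 : 𝕋), z.2)

/-- The deck translation `T(x̃,y) = (x̃+1,y)`. -/
def deckT : StripA → StripA := fun z => (z.1 + 1, z.2)

/-- The iterated deck translation `T^p`, `p ∈ ℤ`. -/
def deckZ (p : ℤ) : StripA → StripA := fun z => (z.1 + (p : ℝ), z.2)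

/-- The boundary circle `C₀ = 𝕋 × {0}`. -/
def C0 : Set Ann := {z | (z.2 : ℝ) = 0}

/-- The boundary circle `C₁ = 𝕋 × {1}`. -/
def C1 : Set Ann := {z | (z.2 : ℝ) = 1}

/-- A point of `Ã` on the boundary line `ℝ × {0}`. -/
def bd0 (x : ℝ) : StripA := (x, ⟨0, by norm_num⟩)

/-- A point of `Ã` on the boundary line `ℝ × {1}`. -/
def bd1 (x : ℝ) : StripA := (x, ⟨1, by norm_num⟩)

/-- A homeomorphism of the closed annulus isotopic to the identity, together with a
chosen lift to the universal cover.  (A homeomorphism of `A` is isotopic to the identity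
iff it admits a lift commuting with the deck translation and preserving each boundary
line of the strip.) -/
structure AnnulusHomeo where
  toFun : Ann ≃ₜ Ann
  lift : StripA ≃ₜ StripA
  lift_proj : ∀ z : StripA, annProj (lift z) = toFun (annProj z)
  lift_deck : ∀ z : StripA, lift (deckT z) = deckT (lift z)
  lift_bd0 : ∀ z : StripA, (z.2 : ℝ) = 0 → ((lift z).2 : ℝ) = 0

/-- The iterate `f^k`, `k ∈ ℤ`. -/
def AnnulusHomeo.iter (h : AnnulusHomeo) (k : ℤ) : Ann → Ann :=
  fun z => ((h.toFun.toEquiv : Equiv.Perm Ann) ^ k) z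

/-- The iterate `f̃^k` of the lift, `k ∈ ℤ`. -/
def AnnulusHomeo.liftIter (h : AnnulusHomeo) (k : ℤ) : StripA → StripA :=
  fun z => ((h.lift.toEquiv : Equiv.Perm StripA) ^ k) z

/-- `f` is non wandering: every nonempty open set meets one of its forward iterates. -/
def NonWandering (h : AnnulusHomeo) : Prop :=
  ∀ U : Set Ann, IsOpen U → U.Nonempty → ∃ k : ℕ, 0 < k ∧ (h.iter k '' U ∩ U).Nonempty

/-- The closed strip `ℝ × [0,1]` inside the plane. -/
def stripS : Set (ℝ × ℝ) := {p | p.2 ∈ Set.Icc (0:ℝ) 1}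

/-- A positive twist map: a `C¹` diffeomorphism of the annulus, isotopic to the identity,
whose lift `F` to the strip (together with its inverse `G`) is continuously differentiable
and satisfies `∂(p̃₁ ∘ f̃)/∂y > 0`, i.e. the first component of `DF(z)·(0,1)` is positive. -/
structure PositiveTwistMap extends AnnulusHomeo where
  F : ℝ × ℝ → ℝ × ℝ
  F' : ℝ × ℝ → (ℝ × ℝ) →L[ℝ] (ℝ × ℝ)
  G : ℝ × ℝ → ℝ × ℝ
  G' : ℝ × ℝ → (ℝ × ℝ) →L[ℝ] (ℝ × ℝ)
  F_lift : ∀ z : StripA, F (z.1, (z.2 : ℝ)) = ((lift z).1, ((lift z).2 : ℝ))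
  G_lift : ∀ z : StripA, G (z.1, (z.2 : ℝ)) = ((lift.symm z).1, ((lift.symm z).2 : ℝ))
  F_hasDeriv : ∀ z ∈ stripS, HasFDerivWithinAt F (F' z) stripS z
  G_hasDeriv : ∀ z ∈ stripS, HasFDerivWithinAt G (G' z) stripS z
  F'_cont : ContinuousOn F' stripS
  G'_cont : ContinuousOn G' stripS
  twist_pos : ∀ z ∈ stripS, 0 < (F' z (0, 1)).1

/-- The oriented angle (in `(-π, π]`) from the vertical vector `(0,1)` to the vector `w`. -/
def angleFromVertical (w : ℝ × ℝ) : ℝ := Complex.arg ⟨w.2, -w.1⟩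

/-- `ρ` is the rotation number of `f` on the boundary circle `C₀`, computed with the lift. -/
def HasRotNum0 (h : AnnulusHomeo) (ρ : ℝ) : Prop :=
  ∀ x : ℝ, Tendsto (fun n : ℕ => ((h.liftIter (n : ℤ) (bd0 x)).1 - x) / (n : ℝ))
    atTop (𝓝 ρ)

/-- `ρ` is the rotation number of `f` on the boundary circle `C₁`, computed with the lift. -/
def HasRotNum1 (h : AnnulusHomeo) (ρ : ℝ) : Prop :=
  ∀ x : ℝ, Tendsto (fun n : ℕ => ((h.liftIter (n : ℤ) (bd1 x)).1 - x) / (n : ℝ))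
    atTop (𝓝 ρ)

/-- A closed `f`-invariant set `X ⊆ A` is well ordered if the first projection is injective
on `X` and the lift preserves the horizontal order on `π⁻¹(X)`. -/
def IsWellOrdered (h : AnnulusHomeo) (X : Set Ann) : Prop :=
  IsClosed X ∧ h.toFun '' X = X ∧
  Set.InjOn (fun z : Ann => z.1) X ∧
  ∀ z₁ z₂ : StripA, annProj z₁ ∈ X → annProj z₂ ∈ X → z₁.1 < z₂.1 →
    (h.lift z₁).1 < (h.lift z₂).1

/-- An essential simple loop in the annulus: the range of an injective continuous map
from the circle that is not null-homotopic. -/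
def IsEssentialSimpleLoop (Γ : Set Ann) : Prop :=
  ∃ γ : C(𝕋, Ann), Function.Injective γ ∧ ¬ γ.Nullhomotopic ∧ Set.range γ = Γ

/-- `Γ` meets each vertical segment `{x} × [0,1]` in exactly one point. -/
def MeetsVerticalsOnce (Γ : Set Ann) : Prop :=
  ∀ x : 𝕋, ∃! z : Ann, z ∈ Γ ∧ z.1 = x

/-- No essential simple loop meeting each vertical segment exactly once is invariant,
except the two boundary circles. -/
def NoInvariantTransverseLoop (h : AnnulusHomeo) : Prop :=
  ∀ Γ : Set Ann, IsEssentialSimpleLoop Γ → MeetsVerticalsOnce Γ →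
    h.toFun '' Γ = Γ → Γ = C0 ∨ Γ = C1

/-- A continuum: a nonempty compact connected set. -/
def IsContinuum (X : Set Ann) : Prop := X.Nonempty ∧ IsCompact X ∧ IsPreconnected X

/-- A lower annulus: an open set homeomorphic to `𝕋 × [0,1)` containing `C₀`. -/
def IsLowerAnnulus (U : Set Ann) : Prop :=
  IsOpen U ∧ Nonempty (↥U ≃ₜ (𝕋 × ↥(Set.Ico (0:ℝ) 1))) ∧ C0 ⊆ U

/-- A lower disk: an open set homeomorphic to `ℝ × [0,1)` meeting `C₀`. -/
def IsLowerDisk (U : Set Ann) : Prop :=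
  IsOpen U ∧ Nonempty (↥U ≃ₜ (ℝ × ↥(Set.Ico (0:ℝ) 1))) ∧ (U ∩ C0).Nonempty

/-- A lower annulus is regular if it is a connected component of the complement of an
essential simple loop. -/
def IsRegularLowerAnnulus (U : Set Ann) : Prop :=
  ∃ Γ : Set Ann, IsEssentialSimpleLoop Γ ∧ ∃ z : Ann, U = connectedComponentIn Γᶜ z

/-- A lower disk is regular if it is a connected component of the complement of a simple
arc joining two points of `C₀` and meeting `C₀` only at its endpoints, or of the
complement of an essential simple loop meeting `C₀` in exactly one point. -/
def IsRegularLowerDisk (U : Set Ann) : Prop :=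
  (∃ a : C(↥(Set.Icc (0:ℝ) 1), Ann), Function.Injective a ∧
      (∀ t : ↥(Set.Icc (0:ℝ) 1), a t ∈ C0 ↔ ((t : ℝ) = 0 ∨ (t : ℝ) = 1)) ∧
      ∃ z : Ann, U = connectedComponentIn (Set.range a)ᶜ z) ∨
  (∃ Γ : Set Ann, IsEssentialSimpleLoop Γ ∧ (∃! z : Ann, z ∈ Γ ∩ C0) ∧
      ∃ z : Ann, U = connectedComponentIn Γᶜ z)

end

namespace AnnulusHomeo

/-- The lift of `h` turns vertical segments to the right. -/
def IsTwist (h : AnnulusHomeo) : Prop :=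
  ∀ x : ℝ, StrictMono fun y : ↥(Set.Icc (0:ℝ) 1) => (h.lift (x, y)).1

lemma surjective_of_add_one {g : ℝ → ℝ} (hg : Continuous g) (h1 : ∀ x, g (x + 1) = g x + 1) :
    Function.Surjective g := by
  have hn : ∀ (n : ℕ) x, g (x + n) = g x + n := by
    intro n
    induction n with
    | zero => simp
    | succ n ih => intro x; push_cast; rw [← add_assoc, h1, ih]; ring
  intro c
  obtain ⟨n, hn1⟩ := exists_nat_ge (|c - g 0|)
  have hb := abs_le.1 hn1
  have h2 : g (-n : ℝ) = g 0 - n := by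
    have := hn n (-n)
    simp only [neg_add_cancel] at this
    linarith
  have h3 : g (n : ℝ) = g 0 + n := by simpa using hn n 0
  have := intermediate_value_Icc (a := (-n : ℝ)) (b := n) (by linarith) hg.continuousOn
  obtain ⟨x, -, hx⟩ := this (show c ∈ Set.Icc (g (-n)) (g n) by
    rw [h2, h3]; constructor <;> linarith)
  exact ⟨x, hx⟩

variable (h : AnnulusHomeo)

lemma lift_add_one_fst (x : ℝ) (y : ↥(Set.Icc (0:ℝ) 1)) :
    (h.lift (x + 1, y)).1 = (h.lift (x, y)).1 + 1 :=
  congrArg Prod.fst (h.lift_deck (x, y))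

lemma continuous_lift_fst (y : ↥(Set.Icc (0:ℝ) 1)) : Continuous fun x : ℝ => (h.lift (x, y)).1 := by
  have := h.lift.continuous
  fun_prop

lemma lift_snd_zero (x : ℝ) : (h.lift (x, 0)).2 = 0 :=
  Subtype.ext (h.lift_bd0 (x, 0) rfl)

lemma strictMono_lift_bottom : StrictMono fun x : ℝ => (h.lift (x, 0)).1 := by
  have hinj : Function.Injective fun x : ℝ => (h.lift (x, 0)).1 := by
    intro x x' hx
    have : h.lift (x, 0) = h.lift (x', 0) :=
      Prod.ext hx (by rw [lift_snd_zero, lift_snd_zero])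
    exact congrArg Prod.fst (h.lift.injective this)
  rcases (h.continuous_lift_fst 0).strictMono_of_inj hinj with hm | hm
  · exact hm
  · have := hm (show (0:ℝ) < 0 + 1 by norm_num)
    simp only [h.lift_add_one_fst] at this
    linarith

/-- The inverse image of the vertical line through `X` meets the bottom. -/
lemma exists_lift_bottom (X : ℝ) : ∃ x, h.lift (x, 0) = (X, 0) := by
  obtain ⟨x, hx⟩ := surjective_of_add_one (h.continuous_lift_fst 0)
    (fun x => h.lift_add_one_fst x 0) X
  exact ⟨x, Prod.ext hx (h.lift_snd_zero x)⟩

variable {h}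

lemma IsTwist.strictAnti_symm (ht : h.IsTwist) (X : ℝ) :
    StrictAnti fun y : ↥(Set.Icc (0:ℝ) 1) => (h.lift.symm (X, y)).1 := by
  have hc : Continuous fun y : ↥(Set.Icc (0:ℝ) 1) => (h.lift.symm (X, y)).1 := by
    have := h.lift.symm.continuous
    fun_prop
  have hinj : Function.Injective fun y : ↥(Set.Icc (0:ℝ) 1) => (h.lift.symm (X, y)).1 := by
    intro y y' hy
    have e1 := h.lift.apply_symm_apply (X, y)
    have e2 := h.lift.apply_symm_apply (X, y')
    have hy' : (h.lift.symm (X, y)).1 = (h.lift.symm (X, y')).1 := hy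
    have : (h.lift.symm (X, y)).2 = (h.lift.symm (X, y')).2 := by
      apply (ht (h.lift.symm (X, y)).1).injective
      simp only [Prod.mk.eta]
      rw [hy', Prod.mk.eta, e1, e2]
    have h3 := h.lift.symm.injective (Prod.ext hy' this)
    exact congrArg Prod.snd h3
  rcases hc.strictMono_of_inj_boundedOrder' hinj with hm | hm
  · exfalso
    obtain ⟨x₀, hx₀⟩ := h.exists_lift_bottom X
    have h0 : h.lift.symm (X, 0) = (x₀, 0) := by rw [← hx₀, h.lift.symm_apply_apply]
    have h01 := hm (show (0 : ↥(Set.Icc (0:ℝ) 1)) < 1 from zero_lt_one)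
    simp only [h0] at h01
    have e1 := congrArg Prod.fst (h.lift.apply_symm_apply (X, 1))
    have h2 := (ht (h.lift.symm (X, 1)).1).monotone (show 0 ≤ (h.lift.symm (X, 1)).2 from
      (h.lift.symm (X, 1)).2.2.1)
    simp only [Prod.mk.eta] at h2
    have h3 := h.strictMono_lift_bottom h01
    simp only [hx₀] at h3
    simp only at e1
    linarith
  · exact hm

/-- A twist map preserves the top line. -/
lemma IsTwist.lift_snd_one (ht : h.IsTwist) (x : ℝ) : (h.lift (x, 1)).2 = 1 := by
  by_contra hne
  set Z := h.lift (x, 1) with hZ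
  have hlt : Z.2 < 1 := lt_of_le_of_ne Z.2.2.2 hne
  have hx : (h.lift.symm (Z.1, 1)).1 < x := by
    have := ht.strictAnti_symm Z.1 hlt
    simpa only [Prod.mk.eta, hZ, h.lift.symm_apply_apply] using this
  have hev : ∀ᶠ X in 𝓝 Z.1, (h.lift.symm (X, 1)).1 < x := by
    have hc : Continuous fun X : ℝ => (h.lift.symm (X, 1)).1 := by
      have := h.lift.symm.continuous
      fun_prop
    exact hc.continuousAt.eventually_lt continuousAt_const hx
  obtain ⟨X, hX, hXx⟩ := (hev.filter_mono nhdsWithin_le_nhds).and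
    (self_mem_nhdsWithin (s := Set.Ioi Z.1)) |>.exists
  have hXx : Z.1 < X := hXx
  obtain ⟨c, hc⟩ := h.exists_lift_bottom X
  have hle : (h.lift (x, 0)).1 ≤ Z.1 :=
    (ht x).monotone (show (0 : ↥(Set.Icc (0:ℝ) 1)) ≤ 1 from zero_le_one)
  have hxc : x < c := by
    by_contra! hcx
    have := h.strictMono_lift_bottom.monotone hcx
    simp only [hc] at this
    linarith
  have hc0 : h.lift.symm (X, 0) = (c, 0) := by rw [← hc, h.lift.symm_apply_apply]
  have hcont : Continuous fun y : ↥(Set.Icc (0:ℝ) 1) => (h.lift.symm (X, y)).1 := by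
    have := h.lift.symm.continuous
    fun_prop
  obtain ⟨y, hy⟩ := mem_range_of_exists_le_of_exists_ge hcont ⟨1, hX.le⟩ ⟨0, by simp [hc0, hxc.le]⟩
  have e1 := congrArg Prod.fst (h.lift.apply_symm_apply (X, y))
  have h2 := (ht x).monotone (show (h.lift.symm (X, y)).2 ≤ 1 from
      (h.lift.symm (X, y)).2.2.2)
  simp only at hy e1 h2
  rw [← hy, Prod.mk.eta, e1, hy, ← hZ] at h2
  linarith

lemma IsTwist.lift_snd_eq_one_iff (ht : h.IsTwist) (z : StripA) : (h.lift z).2 = 1 ↔ z.2 = 1 := by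
  constructor
  · intro hz
    obtain ⟨x, hx⟩ := surjective_of_add_one (h.continuous_lift_fst 1)
      (fun x => h.lift_add_one_fst x 1) (h.lift z).1
    have : h.lift (x, 1) = h.lift z := Prod.ext hx (by rw [ht.lift_snd_one, hz])
    rw [← h.lift.injective this]
  · intro hz
    obtain ⟨x, y⟩ := z
    obtain rfl : y = 1 := hz
    exact ht.lift_snd_one x

/-- The displacement of the lift is bounded. -/
lemma exists_displacement_bound (h : AnnulusHomeo) : ∃ M : ℝ, ∀ z, |(h.lift z).1 - z.1| ≤ M := by
  have hc : Continuous fun z : StripA => |(h.lift z).1 - z.1| := by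
    have := h.lift.continuous
    fun_prop
  obtain ⟨M, hM⟩ := ((isCompact_Icc (a := (0:ℝ)) (b := 1)).prod
    (isCompact_univ (X := ↥(Set.Icc (0:ℝ) 1)))).bddAbove_image hc.continuousOn
  refine ⟨M, fun z => ?_⟩
  have hp : Function.Periodic (fun x : ℝ => |(h.lift (x, z.2)).1 - x|) 1 := by
    intro x
    simp only [h.lift_add_one_fst, add_sub_add_right_eq_sub]
  obtain ⟨x, hx, hxe⟩ := hp.exists_mem_Ico₀ one_pos z.1
  simp only [Prod.mk.eta] at hxe
  rw [hxe]
  exact hM ⟨(x, z.2), ⟨⟨hx.1, hx.2.le⟩, Set.mem_univ _⟩, rfl⟩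

end AnnulusHomeo

/-! ### The winding index of a pair of points -/

/-- The position of `k` with respect to `z`: `0` below, `1` right, `2` above, `3` left. -/
noncomputable def quadrant (z k : StripA) : ℤ :=
  if z.1 < k.1 then 1 else if k.1 < z.1 then 3 else if z.2 < k.2 then 2 else 0

lemma quadrant_eq_two_iff {z k : StripA} : quadrant z k = 2 ↔ z.1 = k.1 ∧ z.2 < k.2 := by
  unfold quadrant
  split_ifs with h1 h2 h3
  · simp [h1.ne]
  · simp [h2.ne']
  · simp [h3, le_antisymm (not_lt.1 h2) (not_lt.1 h1)]
  · simp [h3]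

lemma quadrant_mem (z k : StripA) :
    quadrant z k = 0 ∨ quadrant z k = 1 ∨ quadrant z k = 2 ∨ quadrant z k = 3 := by
  unfold quadrant
  split_ifs <;> simp

/-- Off the diagonal, the position varies locally by at most one quarter turn. -/
lemma eventually_quadrant {z k : StripA} (hk : k ≠ z) :
    ∀ᶠ k' in 𝓝 k, (quadrant z k % 2 = 1 → quadrant z k' = quadrant z k) ∧
      (quadrant z k % 2 = 0 → (quadrant z k' - quadrant z k) % 4 ≠ 2) := by
  have c1 : ContinuousAt (fun w : StripA => w.1) k := continuous_fst.continuousAt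
  have c2 : ContinuousAt (fun w : StripA => w.2) k := continuous_snd.continuousAt
  rcases lt_trichotomy z.1 k.1 with h1 | h1 | h1
  · filter_upwards [continuousAt_const.eventually_lt c1 h1] with k' hk'
    simp [quadrant, h1, hk']
  · have hne : z.2 ≠ k.2 := fun h2 => hk (Prod.ext h1.symm h2.symm)
    rcases lt_or_gt_of_ne hne with h2 | h2
    · filter_upwards [continuousAt_const.eventually_lt c2 h2] with k' hk'
      simp only [quadrant, h1, h2, hk']
      split_ifs <;> simp_all
    · filter_upwards [c2.eventually_lt continuousAt_const h2] with k' hk'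
      simp only [quadrant, h1, h2.not_gt, hk'.not_gt]
      split_ifs <;> simp_all
  · filter_upwards [c1.eventually_lt continuousAt_const h1] with k' hk'
    simp [quadrant, h1, h1.not_gt, hk', hk'.not_gt]

namespace AnnulusHomeo

variable {h : AnnulusHomeo}

/-- A twist map turns directions clockwise, by less than half a turn. -/
lemma IsTwist.quadrant_lift (ht : h.IsTwist) {z k : StripA} (hk : k ≠ z) :
    (quadrant z k - quadrant (h.lift z) (h.lift k)) % 4 ≤ 2 ∧
      (quadrant z k % 2 = 0 → (quadrant z k - quadrant (h.lift z) (h.lift k)) % 4 = 1) := by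
  have key : ∀ {a b : StripA}, a.1 < b.1 → (h.lift a).1 = (h.lift b).1 →
      (h.lift b).2 < (h.lift a).2 := by
    intro a b hab he
    have := (ht.strictAnti_symm (h.lift a).1).lt_iff_gt (a := (h.lift a).2) (b := (h.lift b).2)
    simp only [Prod.mk.eta, h.lift.symm_apply_apply] at this
    rw [he, Prod.mk.eta, h.lift.symm_apply_apply] at this
    exact this.1 hab
  obtain ⟨zx, zy⟩ := z
  obtain ⟨kx, ky⟩ := k
  rcases lt_trichotomy zx kx with h1 | h1 | h1
  · have := @key (zx, zy) (kx, ky) h1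
    simp only [quadrant, h1, if_true]
    split_ifs with h2 h3 h4 <;> norm_num
    exact absurd h4 (this (le_antisymm (not_lt.1 h3) (not_lt.1 h2))).not_gt
  · subst h1
    have hne : zy ≠ ky := fun h2 => hk (Prod.ext rfl h2.symm)
    rcases lt_or_gt_of_ne hne with h2 | h2
    · have : (h.lift (zx, zy)).1 < (h.lift (zx, ky)).1 := ht zx h2
      simp [quadrant, h2, this]
    · have : (h.lift (zx, ky)).1 < (h.lift (zx, zy)).1 := ht zx h2
      simp [quadrant, h2.not_gt, this, this.not_gt]
  · have := @key (kx, ky) (zx, zy) h1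
    simp only [quadrant, h1, h1.not_gt, if_true, if_false]
    split_ifs with h2 h3 h4 <;> norm_num
    exact absurd (this (le_antisymm (not_lt.1 h2) (not_lt.1 h3))) h4

/-- The winding index of the images of `k` around the images of `z`, counted in quarter turns. -/
noncomputable def wind (h : AnnulusHomeo) (z k : StripA) : ℕ → ℤ
  | 0 => 1 - (1 - quadrant z k) % 4
  | n + 1 => wind h z k n -
      (wind h z k n - quadrant (h.lift^[n + 1] z) (h.lift^[n + 1] k)) % 4

lemma wind_emod (h : AnnulusHomeo) (z k : StripA) (n : ℕ) :
    (h.wind z k n - quadrant (h.lift^[n] z) (h.lift^[n] k)) % 4 = 0 := by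
  cases n with
  | zero => simp only [wind, Function.iterate_zero, id]; omega
  | succ n => simp only [wind]; omega

lemma wind_antitone (h : AnnulusHomeo) (z k : StripA) : Antitone (h.wind z k) := by
  refine antitone_nat_of_succ_le fun n => ?_
  simp only [wind]
  omega

lemma wind_zero_le (h : AnnulusHomeo) (z k : StripA) : h.wind z k 0 ≤ 1 := by
  simp only [wind]
  omega

lemma iterate_ne (h : AnnulusHomeo) {z k : StripA} (hk : k ≠ z) (n : ℕ) :
    h.lift^[n] k ≠ h.lift^[n] z := fun e => hk (h.lift.injective.iterate n e)

lemma IsTwist.wind_step (ht : h.IsTwist) {z k : StripA} (hk : k ≠ z) (n : ℕ) :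
    h.wind z k n - 2 ≤ h.wind z k (n + 1) ∧ h.wind z k (n + 1) ≤ h.wind z k n ∧
      (h.wind z k n % 2 = 0 → h.wind z k (n + 1) = h.wind z k n - 1) := by
  have h1 := ht.quadrant_lift (iterate_ne h hk n)
  rw [← Function.iterate_succ_apply' h.lift, ← Function.iterate_succ_apply' h.lift,
    Nat.succ_eq_add_one] at h1
  have h2 := wind_emod h z k n
  simp only [wind]
  omega

/-- The winding index varies locally by at most one quarter turn, away from the vertical
above `z`. -/
lemma IsTwist.eventually_wind (ht : h.IsTwist) {z k : StripA} {K : Set StripA}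
    (hk : k ∈ K) (hK : ∀ k ∈ K, k ≠ z ∧ quadrant z k ≠ 2) (n : ℕ) :
    ∀ᶠ k' in 𝓝[K] k, |h.wind z k' n - h.wind z k n| ≤ 1 := by
  have hq : ∀ n : ℕ, ∀ᶠ k' in 𝓝[K] k,
      (quadrant (h.lift^[n] z) (h.lift^[n] k) % 2 = 1 →
        quadrant (h.lift^[n] z) (h.lift^[n] k') = quadrant (h.lift^[n] z) (h.lift^[n] k)) ∧
      (quadrant (h.lift^[n] z) (h.lift^[n] k) % 2 = 0 →
        (quadrant (h.lift^[n] z) (h.lift^[n] k') -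
          quadrant (h.lift^[n] z) (h.lift^[n] k)) % 4 ≠ 2) := fun n =>
    (((h.lift.continuous.iterate n).continuousAt (x := k)).eventually
      (eventually_quadrant (iterate_ne h (hK k hk).1 n))).filter_mono nhdsWithin_le_nhds
  induction n with
  | zero =>
    filter_upwards [hq 0, self_mem_nhdsWithin] with k' h1 h2
    have h3 := (hK k hk).2
    have h4 := (hK k' h2).2
    have h5 := quadrant_mem z k
    have h6 := quadrant_mem z k'
    simp only [Function.iterate_zero, id] at h1
    simp only [wind]
    rw [abs_le]
    omega
  | succ n ih =>
    filter_upwards [hq n, hq (n + 1), ih, self_mem_nhdsWithin] with k' h1 h2 h3 h4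
    have a1 := ht.wind_step (hK k hk).1 n
    have a2 := ht.wind_step (hK k' h4).1 n
    have b1 := wind_emod h z k n
    have b2 := wind_emod h z k' n
    have b3 := wind_emod h z k (n + 1)
    have b4 := wind_emod h z k' (n + 1)
    rw [abs_le] at h3 ⊢
    omega

end AnnulusHomeo

/-! ### The region above a closed set -/

lemma continuous_annProj : Continuous annProj :=
  ((AddCircle.continuous_mk' (1:ℝ)).comp continuous_fst).prodMk continuous_snd

lemma isOpenMap_annProj : IsOpenMap annProj :=
  QuotientAddGroup.isOpenMap_coe.prodMap IsOpenMap.id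

lemma surjective_annProj : Function.Surjective annProj := by
  rintro ⟨x, y⟩
  obtain ⟨t, rfl⟩ := QuotientAddGroup.mk_surjective x
  exact ⟨(t, y), rfl⟩

/-- The preimage in the strip of a connected set containing `C0` has no bounded relatively
clopen part away from the bottom line. -/
lemma eq_empty_of_compact_of_relatively_open {Y : Set Ann} (hY : IsPreconnected Y) (hC0 : C0 ⊆ Y)
    {E U : Set StripA} (hE : IsCompact E) (hU : IsOpen U) (hEU : E = U ∩ annProj ⁻¹' Y)
    (hbot : ∀ k ∈ E, k.2 ≠ 0) : E = ∅ := by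
  by_contra hne
  obtain ⟨k, hk⟩ := Set.nonempty_iff_ne_empty.2 hne
  have hclosed : IsClosed (annProj '' E) := (hE.image continuous_annProj).isClosed
  have hbotY : annProj (0, 0) ∈ Y := hC0 rfl
  have hb : annProj (0, 0) ∉ annProj '' E := by
    rintro ⟨w, hw, hwe⟩
    exact hbot w hw (congrArg Prod.snd hwe)
  obtain ⟨w, hwY, hwU, hwE⟩ := hY (annProj '' U) (annProj '' E)ᶜ (isOpenMap_annProj U hU)
    hclosed.isOpen_compl
    (fun w hw => by
      by_cases hwE : w ∈ annProj '' E
      · exact Or.inl (Set.image_mono (hEU ▸ Set.inter_subset_left) hwE)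
      · exact Or.inr hwE)
    ⟨annProj k, (hEU ▸ hk).2, k, (hEU ▸ hk).1, rfl⟩ ⟨_, hbotY, hb⟩
  obtain ⟨u, hu, rfl⟩ := hwU
  exact hwE ⟨u, hEU ▸ ⟨hu, hwY⟩, rfl⟩

/-- The set of points which can be joined to the top circle by a vertical segment avoiding `Y`. -/
def upperRegion (Y : Set Ann) : Set Ann := {z | ∀ y, z.2 ≤ y → (z.1, y) ∉ Y}

lemma isOpen_upperRegion {Y : Set Ann} (hY : IsClosed Y) : IsOpen (upperRegion Y) := by
  rw [← isClosed_compl_iff]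
  have hc : IsClosed {p : Ann × ↥(Set.Icc (0:ℝ) 1) | p.1.2 ≤ p.2 ∧ (p.1.1, p.2) ∈ Y} :=
    (isClosed_le (by fun_prop) (by fun_prop)).inter (hY.preimage (by fun_prop))
  convert isClosedMap_fst_of_compactSpace _ hc using 1
  ext z
  simp only [upperRegion, Set.mem_compl_iff, Set.mem_ofPred_eq, not_forall, not_not, exists_prop]
  refine ⟨fun ⟨y, hy⟩ => ⟨(z, y), hy, rfl⟩, ?_⟩
  rintro ⟨⟨w, y⟩, hy, rfl⟩
  exact ⟨y, hy⟩

lemma upperRegion_subset_compl (Y : Set Ann) : upperRegion Y ⊆ Yᶜ := fun z hz => hz z.2 le_rfl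

lemma upperRegion_up {Y : Set Ann} {z : Ann} (hz : z ∈ upperRegion Y) {y : ↥(Set.Icc (0:ℝ) 1)}
    (hy : z.2 ≤ y) : (z.1, y) ∈ upperRegion Y := fun _ hy' => hz _ (hy.trans hy')

namespace AnnulusHomeo

variable {h : AnnulusHomeo}

lemma semiconj (h : AnnulusHomeo) : Function.Semiconj annProj h.lift h.toFun := h.lift_proj

lemma exists_displacement_bound_iterate (h : AnnulusHomeo) :
    ∃ M : ℝ, 0 ≤ M ∧ ∀ n : ℕ, ∀ z, |(h.lift^[n] z).1 - z.1| ≤ n * M := by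
  obtain ⟨M, hM⟩ := h.exists_displacement_bound
  refine ⟨M, (abs_nonneg _).trans (hM (0, 0)), fun n z => ?_⟩
  induction n with
  | zero => simp
  | succ n ih =>
    rw [Function.iterate_succ_apply']
    have h1 := hM (h.lift^[n] z)
    push_cast
    calc _ = |((h.lift (h.lift^[n] z)).1 - (h.lift^[n] z).1) + ((h.lift^[n] z).1 - z.1)| := by
          congr 1; ring
      _ ≤ _ := abs_add_le _ _
      _ ≤ _ := by linarith

/-- The winding index is `1` or `-1` for points far away. -/
lemma exists_bound_of_wind_lt (h : AnnulusHomeo) (z : StripA) (n : ℕ) :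
    ∃ R : ℝ, ∀ k : StripA, h.wind z k n < -1 → |k.1 - z.1| ≤ R := by
  obtain ⟨M, hM0, hM⟩ := h.exists_displacement_bound_iterate
  refine ⟨2 * n * M, fun k hk => ?_⟩
  by_contra! hlt
  have hj : ∀ j : ℕ, j ≤ n →
      |(h.lift^[j] k).1 - k.1| ≤ n * M ∧ |(h.lift^[j] z).1 - z.1| ≤ n * M := by
    intro j hj
    have : (j : ℝ) * M ≤ n * M := by gcongr
    exact ⟨(hM j k).trans this, (hM j z).trans this⟩
  rcases lt_abs.1 hlt with h1 | h1
  · have hq : ∀ j ≤ n, quadrant (h.lift^[j] z) (h.lift^[j] k) = 1 := by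
      intro j hjn
      obtain ⟨a, b⟩ := hj j hjn
      rw [abs_le] at a b
      have : (h.lift^[j] z).1 < (h.lift^[j] k).1 := by linarith
      simp [quadrant, this]
    have hw : ∀ j ≤ n, h.wind z k j = 1 := by
      intro j
      induction j with
      | zero =>
        intro h0
        have := hq 0 h0
        simp only [Function.iterate_zero, id] at this
        simp [wind, this]
      | succ j ih => intro hj1; rw [wind, ih (by omega), hq _ hj1]; norm_num
    have := hw n le_rfl
    omega
  · have hq : ∀ j ≤ n, quadrant (h.lift^[j] z) (h.lift^[j] k) = 3 := by
      intro j hjn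
      obtain ⟨a, b⟩ := hj j hjn
      rw [abs_le] at a b
      have : (h.lift^[j] k).1 < (h.lift^[j] z).1 := by linarith
      simp [quadrant, this, this.not_gt]
    have hw : ∀ j ≤ n, h.wind z k j = -1 := by
      intro j
      induction j with
      | zero =>
        intro h0
        have := hq 0 h0
        simp only [Function.iterate_zero, id] at this
        simp [wind, this]
      | succ j ih => intro hj1; rw [wind, ih (by omega), hq _ hj1]; norm_num
    have := hw n le_rfl
    omega

lemma iterate_lift_snd_zero (h : AnnulusHomeo) {k : StripA} (hk : k.2 = 0) (n : ℕ) :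
    (h.lift^[n] k).2 = 0 := by
  induction n with
  | zero => exact hk
  | succ n ih =>
    rw [Function.iterate_succ_apply']
    exact Subtype.ext (h.lift_bd0 _ (congrArg Subtype.val ih))

lemma IsTwist.wind_bottom (ht : h.IsTwist) {z k : StripA} (hkz : k ≠ z) (hk : k.2 = 0) (n : ℕ) :
    -1 ≤ h.wind z k n := by
  induction n with
  | zero =>
    have h1 : quadrant z k ≠ 2 := by
      rw [Ne, quadrant_eq_two_iff, hk]
      exact fun h2 => absurd h2.2 (not_lt.2 z.2.2.1)
    have := quadrant_mem z k
    simp only [wind]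
    omega
  | succ n ih =>
    have h1 := ht.wind_step hkz n
    by_cases hw : h.wind z k n = -1
    · have h2 := wind_emod h z k n
      have h3 := quadrant_mem (h.lift^[n] z) (h.lift^[n] k)
      have h4 : quadrant (h.lift^[n] z) (h.lift^[n] k) = 3 := by omega
      have h5 : (h.lift^[n] k).1 < (h.lift^[n] z).1 := by
        unfold quadrant at h4
        split_ifs at h4 <;> first | assumption | omega
      have h6 : quadrant (h.lift^[n + 1] z) (h.lift^[n + 1] k) = 3 := by
        rw [Function.iterate_succ_apply', Function.iterate_succ_apply']
        have e : h.lift^[n] k = ((h.lift^[n] k).1, 0) :=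
          Prod.ext rfl (h.iterate_lift_snd_zero hk n)
        have a : (h.lift (h.lift^[n] k)).1 < (h.lift ((h.lift^[n] z).1, 0)).1 := by
          rw [e]; exact h.strictMono_lift_bottom h5
        have b : (h.lift ((h.lift^[n] z).1, 0)).1 ≤ (h.lift (h.lift^[n] z)).1 :=
          (ht (h.lift^[n] z).1).monotone (show 0 ≤ (h.lift^[n] z).2 from (h.lift^[n] z).2.2.1)
        have c := a.trans_le b
        simp [quadrant, c, c.not_gt]
      have h7 := wind_emod h z k (n + 1)
      omega
    · have h2 := wind_antitone h z k (Nat.zero_le n)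
      have h3 := wind_zero_le h z k
      have h4 : h.wind z k n = 0 ∨ h.wind z k n = 1 := by omega
      omega

/-- An orbit segment of a twist map with both endpoints in the region above an invariant
connected set stays in this region. -/
lemma IsTwist.iterate_mem_upperRegion (ht : h.IsTwist) {Y : Set Ann} (hYc : IsClosed Y)
    (hY : IsPreconnected Y) (hC0 : C0 ⊆ Y) (hinv : ∀ z, h.toFun z ∈ Y ↔ z ∈ Y) {p : Ann} {n j : ℕ}
    (hp : p ∈ upperRegion Y) (hpn : h.toFun^[n] p ∈ upperRegion Y) (hjn : j ≤ n) :
    h.toFun^[j] p ∈ upperRegion Y := by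
  obtain ⟨z, rfl⟩ := surjective_annProj p
  have hsemi : ∀ (i : ℕ) w, annProj (h.lift^[i] w) = h.toFun^[i] (annProj w) := fun i w =>
    h.semiconj.iterate_right i w
  have hinvn : ∀ (i : ℕ) w, h.toFun^[i] w ∈ Y ↔ w ∈ Y := by
    intro i w
    induction i with
    | zero => rfl
    | succ i ih => rw [Function.iterate_succ_apply', hinv, ih]
  set K := annProj ⁻¹' Y with hKdef
  have hKc : IsClosed K := hYc.preimage continuous_annProj
  have hLK : ∀ (i : ℕ) w, h.lift^[i] w ∈ K ↔ w ∈ K := by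
    intro i w
    rw [hKdef, Set.mem_preimage, hsemi, hinvn, Set.mem_preimage]
  have hV : ∀ {w k : StripA}, annProj w ∈ upperRegion Y → k ∈ K → k ≠ w ∧ quadrant w k ≠ 2 := by
    intro w k hw hk
    constructor
    · rintro rfl
      exact upperRegion_subset_compl Y hw hk
    · intro hq
      obtain ⟨h1, h2⟩ := quadrant_eq_two_iff.1 hq
      refine hw k.2 h2.le ?_
      have : annProj k ∈ Y := hk
      simpa only [annProj, h1] using this
  have hKz : ∀ k ∈ K, k ≠ z ∧ quadrant z k ≠ 2 := fun k hk => hV hp hk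
  rw [← hsemi] at hpn
  have hne2 : ∀ k ∈ K, h.wind z k n ≠ -2 := by
    intro k hk hw
    have h1 := (hV hpn ((hLK n k).2 hk)).2
    have h2 := wind_emod h z k n
    have h3 := quadrant_mem (h.lift^[n] z) (h.lift^[n] k)
    omega
  set E : Set StripA := {k | k ∈ K ∧ h.wind z k n < -1} with hE
  have hEclosed : IsClosed E := by
    refine isClosed_of_closure_subset fun k hk => ?_
    have hkK : k ∈ K := hKc.closure_subset_iff.2 (fun w hw => hw.1) hk
    obtain ⟨w, hw1, hw2⟩ := ((mem_closure_iff_frequently.1 hk).and_eventually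
      (eventually_nhdsWithin_iff.1 (ht.eventually_wind hkK hKz n))).exists
    have h1 := hw2 hw1.1
    have h2 := hw1.2
    have h3 := hne2 w hw1.1
    rw [abs_le] at h1
    exact ⟨hkK, by omega⟩
  obtain ⟨R, hR⟩ := h.exists_bound_of_wind_lt z n
  have hEcompact : IsCompact E := by
    refine ((isCompact_Icc (a := z.1 - R) (b := z.1 + R)).prod isCompact_univ).of_isClosed_subset
      hEclosed fun k hk => ⟨?_, Set.mem_univ _⟩
    have := abs_le.1 (hR k hk.2)
    constructor <;> linarith
  have hEempty : E = ∅ := by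
    refine eq_empty_of_compact_of_relatively_open hY hC0 hEcompact
      (U := ⋃₀ {O | IsOpen O ∧ O ∩ K ⊆ E}) (isOpen_sUnion fun O hO => hO.1) ?_ ?_
    · apply Set.Subset.antisymm
      · intro k hk
        have h1 : ∀ᶠ w in 𝓝[K] k, w ∈ E := by
          filter_upwards [ht.eventually_wind hk.1 hKz n, self_mem_nhdsWithin] with w hw hwK
          have h2 := hne2 k hk.1
          have h3 := hne2 w hwK
          have h4 := hk.2
          rw [abs_le] at hw
          exact ⟨hwK, by omega⟩
        obtain ⟨O, hO, hkO, hOK⟩ := mem_nhdsWithin.1 h1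
        exact ⟨Set.mem_sUnion.2 ⟨O, ⟨hO, hOK⟩, hkO⟩, hk.1⟩
      · rintro k ⟨⟨O, hO, hkO⟩, hkK⟩
        exact hO.2 ⟨hkO, hkK⟩
    · intro k hk hk0
      have := ht.wind_bottom (hKz k hk.1).1 hk0 n
      have := hk.2
      omega
  rw [← hsemi]
  intro y hy hyY
  set κ : StripA := ((h.lift^[j] z).1, y) with hκ
  obtain ⟨k, hk⟩ := h.lift.surjective.iterate j κ
  have hkK : k ∈ K := (hLK j k).1 (by rw [hk]; exact hyY)
  have hwn : ¬ h.wind z k n < -1 := fun hlt => by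
    have : k ∈ E := ⟨hkK, hlt⟩
    rw [hEempty] at this
    exact this
  have hq : quadrant (h.lift^[j] z) (h.lift^[j] k) = 2 := by
    rw [hk, quadrant_eq_two_iff]
    refine ⟨rfl, lt_of_le_of_ne hy fun he => ?_⟩
    exact iterate_ne h (hKz k hkK).1 j (hk.trans (Prod.ext rfl he.symm))
  have h1 := wind_emod h z k j
  have h2 := wind_antitone h z k hjn
  have h3 := wind_antitone h z k (Nat.zero_le j)
  have h4 := wind_zero_le h z k
  omega

end AnnulusHomeo

/-- An open set disjoint from a connected set `Y` containing `C0`, in which the region above `Y`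
is dense, is contained in this region. -/
lemma subset_upperRegion_of_subset_closure {Y : Set Ann} (hYc : IsClosed Y) (hY : IsPreconnected Y)
    (hC0 : C0 ⊆ Y) {N : Set Ann} (hN : IsOpen N) (hNY : N ⊆ Yᶜ)
    (hNV : N ⊆ closure (upperRegion Y)) : N ⊆ upperRegion Y := by
  intro p hp y₁ hy₁ hy₁Y
  obtain ⟨⟨x, y⟩, rfl⟩ := surjective_annProj p
  simp only [annProj] at hy₁ hy₁Y
  have hN' : IsOpen (annProj ⁻¹' N) := hN.preimage continuous_annProj
  obtain ⟨ε, hε, hball⟩ := Metric.isOpen_iff.1 hN' (x, y) hp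
  have hbox : ∀ (t : ℝ) (η : ↥(Set.Icc (0:ℝ) 1)), |t - x| < ε → |(η : ℝ) - y| < ε →
      annProj (t, η) ∈ N := by
    intro t η ht hη
    exact hball (by rw [Metric.mem_ball, Prod.dist_eq]; exact max_lt ht hη)
  have hdense : ∀ c d t : ℝ, c < t → t < d → |t - x| < ε →
      ∃ (a : ℝ) (η : ↥(Set.Icc (0:ℝ) 1)), c < a ∧ a < d ∧ |(η : ℝ) - y| < ε ∧
        annProj (a, η) ∈ upperRegion Y := by
    intro c d t hc hd ht
    have hcl := hNV (hbox t y ht (by simpa using hε))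
    obtain ⟨w, ⟨⟨a, η⟩, ⟨⟨ha1, ha2⟩, hη⟩, rfl⟩, hwV⟩ := mem_closure_iff.1 hcl
      (annProj '' (Set.Ioo c d ×ˢ Metric.ball y ε))
      (isOpenMap_annProj _ (isOpen_Ioo.prod Metric.isOpen_ball))
      ⟨(t, y), ⟨⟨hc, hd⟩, Metric.mem_ball_self hε⟩, rfl⟩
    exact ⟨a, η, ha1, ha2, hη, hwV⟩
  obtain ⟨a, ya, ha1, ha2, hya, haV⟩ := hdense (x - ε) x (x - ε / 2) (by linarith) (by linarith)
    (by rw [abs_lt]; constructor <;> linarith)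
  obtain ⟨b, yb, hb1, hb2, hyb, hbV⟩ := hdense x (x + ε) (x + ε / 2) (by linarith) (by linarith)
    (by rw [abs_lt]; constructor <;> linarith)
  have hside : ∀ {c : ℝ} {yc η : ↥(Set.Icc (0:ℝ) 1)}, |c - x| < ε → |(yc : ℝ) - y| < ε →
      annProj (c, yc) ∈ upperRegion Y → y ≤ η → annProj (c, η) ∉ Y := by
    intro c yc η hc hyc hcV hη
    rcases le_or_gt yc η with h1 | h1
    · exact hcV η h1
    · refine hNY (hbox c η hc ?_)
      have h2 : (y : ℝ) ≤ η := hη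
      have h3 : (η : ℝ) < yc := h1
      rw [abs_lt] at hyc ⊢
      constructor <;> linarith
  have hE : (Set.Icc a b ×ˢ Set.Ici y) ∩ annProj ⁻¹' Y =
      (Set.Ioo a b ×ˢ Set.Ioi y) ∩ annProj ⁻¹' Y := by
    apply Set.Subset.antisymm
    · rintro ⟨t, η⟩ ⟨⟨⟨ht1, ht2⟩, hη⟩, htY⟩
      simp only at ht1 ht2
      refine ⟨⟨⟨lt_of_le_of_ne ht1 ?_, lt_of_le_of_ne ht2 ?_⟩,
        show y < η from lt_of_le_of_ne hη ?_⟩, htY⟩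
      · rintro rfl
        exact hside (by rw [abs_lt]; constructor <;> linarith) hya haV hη htY
      · rintro rfl
        exact hside (by rw [abs_lt]; constructor <;> linarith) hyb hbV hη htY
      · intro he
        subst he
        exact hNY (hbox t y (by rw [abs_lt]; constructor <;> linarith) (by simpa using hε)) htY
    · exact Set.inter_subset_inter_left _
        (Set.prod_mono Set.Ioo_subset_Icc_self Set.Ioi_subset_Ici_self)
  have hempty := eq_empty_of_compact_of_relatively_open hY hC0
    ((isCompact_Icc.prod (isClosed_Ici.isCompact)).inter_right (hYc.preimage continuous_annProj))
    (isOpen_Ioo.prod isOpen_Ioi) hE (by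
      rw [hE]
      rintro k ⟨⟨-, hk⟩, -⟩ hk0
      have hk' : y < k.2 := hk
      rw [hk0] at hk'
      exact absurd hk' (not_lt.2 y.2.1))
  have hmem : (x, y₁) ∈ (Set.Icc a b ×ˢ Set.Ici y) ∩ annProj ⁻¹' Y :=
    ⟨⟨⟨ha2.le, hb1.le⟩, hy₁⟩, hy₁Y⟩
  rw [hempty] at hmem
  exact hmem

/-- A closed set meeting each vertical exactly once is the range of a continuous section. -/
lemma exists_section_of_meetsVerticalsOnce {Γ : Set Ann} (hΓ : IsClosed Γ)
    (hv : MeetsVerticalsOnce Γ) : ∃ γ : C(𝕋, Ann), (∀ x, (γ x).1 = x) ∧ Set.range γ = Γ := by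
  have hbij : Function.Bijective fun z : Γ => z.1.1 := by
    constructor
    · intro z w hzw
      exact Subtype.ext ((hv w.1.1).unique ⟨z.2, hzw⟩ ⟨w.2, rfl⟩)
    · intro x
      obtain ⟨z, ⟨hz, hzx⟩, -⟩ := hv x
      exact ⟨⟨z, hz⟩, hzx⟩
  have : CompactSpace Γ := isCompact_iff_compactSpace.1 hΓ.isCompact
  have hc : Continuous (Equiv.ofBijective _ hbij) :=
    show Continuous fun z : Γ => z.1.1 by fun_prop
  let e : Γ ≃ₜ 𝕋 := hc.homeoOfEquivCompactToT2
  refine ⟨⟨fun x => (e.symm x : Ann), by fun_prop⟩, fun x => e.apply_symm_apply x, ?_⟩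
  ext z
  constructor
  · rintro ⟨x, rfl⟩
    exact (e.symm x).2
  · intro hz
    exact ⟨e ⟨z, hz⟩, congrArg Subtype.val (e.symm_apply_apply ⟨z, hz⟩)⟩

lemma not_nullhomotopic_id_circle : ¬ (ContinuousMap.id 𝕋).Nullhomotopic := by
  rintro ⟨c, ⟨H⟩⟩
  obtain ⟨t, rfl⟩ := QuotientAddGroup.mk_surjective c
  have cov : IsCoveringMap ((↑) : ℝ → 𝕋) := AddCircle.isCoveringMap_coe 1
  have H0 : ∀ a, H.symm (0, a) = ((ContinuousMap.const 𝕋 t a : ℝ) : 𝕋) := fun a => by simp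
  let g : 𝕋 → ℝ := fun a => cov.liftHomotopy H.symm.toContinuousMap (.const 𝕋 t) H0 (1, a)
  have hg : Continuous g := by fun_prop
  have hlift : ∀ a : 𝕋, ((g a : ℝ) : 𝕋) = a := fun a => by
    have := congrFun (cov.liftHomotopy_lifts H.symm.toContinuousMap (.const 𝕋 t) H0) (1, a)
    exact this.trans (H.symm.apply_one a)
  have hgc : Continuous fun x : ℝ => g (x : 𝕋) := hg.comp (AddCircle.continuous_mk' 1)
  -- the difference between `g x` and `x` is an integer depending continuously on `x`
  have hint : ∀ x : ℝ, ∃ n : ℤ, g (x : 𝕋) - x = n := by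
    intro x
    have h1 : ((g (x : 𝕋) - x : ℝ) : 𝕋) = 0 := by
      rw [AddCircle.coe_sub, hlift, sub_self]
    obtain ⟨n, hn⟩ := (AddCircle.coe_eq_zero_iff (1:ℝ)).1 h1
    exact ⟨n, by simpa using hn.symm⟩
  choose n hn using hint
  have hnc : Continuous n := by
    have : Continuous fun x => (n x : ℝ) := by
      simp only [← hn]
      fun_prop
    exact Int.isClosedEmbedding_coe_real.isInducing.continuous_iff.2 this
  have hconst : n 0 = n 1 := PreconnectedSpace.constant inferInstance hnc
  have h0 := hn 0
  have h1 := hn 1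
  have h2 : ((1 : ℝ) : 𝕋) = ((0 : ℝ) : 𝕋) := by
    rw [AddCircle.coe_period, AddCircle.coe_zero]
  rw [h2] at h1
  rw [hconst] at h0
  linarith

lemma isEssentialSimpleLoop_of_meetsVerticalsOnce {Γ : Set Ann} (hΓ : IsClosed Γ)
    (hv : MeetsVerticalsOnce Γ) : IsEssentialSimpleLoop Γ := by
  obtain ⟨γ, hγ, hr⟩ := exists_section_of_meetsVerticalsOnce hΓ hv
  refine ⟨γ, fun x x' hx => by rw [← hγ x, hx, hγ x'], fun hn => ?_, hr⟩
  have := hn.comp_right (⟨Prod.fst, continuous_fst⟩ : C(Ann, 𝕋))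
  refine not_nullhomotopic_id_circle ?_
  convert this
  ext x
  exact (hγ x).symm

/-- Near a point `z`, an invariant region which is upward closed and accumulates on `z` from the
appropriate side contains all points above `z`. -/
lemma mem_of_frequently_mem_side (H : StripA ≃ₜ StripA) {σ : ℝ} (hσ : σ ≠ 0)
    (hH : ∀ x, StrictMono fun y => σ * (H (x, y)).1) (htop : ∀ z, (H z).2 = 1 ↔ z.2 = 1)
    {V : Set StripA} (hup : ∀ z ∈ V, ∀ y, z.2 ≤ y → (z.1, y) ∈ V) (hVH : ∀ z, H z ∈ V ↔ z ∈ V)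
    {z : StripA} {y₁ : ↥(Set.Icc (0:ℝ) 1)} (hy : z.2 < y₁)
    (hf : ∃ᶠ q in 𝓝 z, q ∈ V ∧ σ * q.1 ≤ σ * z.1) : (z.1, y₁) ∈ V := by
  have hHc := H.continuous
  have hHs := H.symm.continuous
  obtain ⟨p, rfl⟩ := H.surjective z
  have hp1 : (p.2 : ℝ) < 1 := by
    refine lt_of_le_of_ne p.2.2.2 fun he => ?_
    have h1 := (htop p).2 (Subtype.ext he)
    rw [h1] at hy
    exact absurd hy (not_lt.2 y₁.2.2)
  have hopen : IsOpen {w : StripA | (H w).2 < y₁} :=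
    isOpen_lt (continuous_snd.comp hHc) continuous_const
  obtain ⟨ε, hε, hball⟩ := Metric.isOpen_iff.1 hopen p hy
  have hp0 := p.2.2.1
  obtain ⟨B, hB⟩ : ∃ B : ↥(Set.Icc (0:ℝ) 1), (B : ℝ) = min 1 (p.2 + ε / 2) :=
    ⟨⟨min 1 (p.2 + ε / 2), le_min zero_le_one (by linarith), min_le_left _ _⟩, rfl⟩
  have hpB : p.2 < B := by
    rw [← Subtype.coe_lt_coe, hB]
    exact lt_min hp1 (by linarith)
  have hBε : (B : ℝ) ≤ p.2 + ε / 2 := hB ▸ min_le_right _ _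
  have hev : ∀ᶠ q in 𝓝 (H p), H.symm q ∈ Metric.ball p ε ∧ (H.symm q).2 < B ∧
      σ * (H p).1 < σ * (H ((H.symm q).1, B)).1 := by
    have e : H.symm (H p) = p := H.symm_apply_apply p
    refine (hHs.continuousAt.eventually_mem (by
      rw [e]; exact Metric.ball_mem_nhds p hε)).and (Filter.Eventually.and ?_ ?_)
    · exact ContinuousAt.eventually_lt (by fun_prop) (by fun_prop) (by rw [e]; exact hpB)
    · exact ContinuousAt.eventually_lt (by fun_prop) (by fun_prop) (by
        rw [e]; exact hH p.1 hpB)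
  obtain ⟨q, ⟨hqV, hqle⟩, hw, hwB, hwlt⟩ := (hf.and_eventually hev).exists
  obtain ⟨w, rfl⟩ := H.surjective q
  rw [H.symm_apply_apply] at hw hwB hwlt
  have hc : Continuous fun s => σ * (H (w.1, s)).1 := by fun_prop
  obtain ⟨s, ⟨hs1, hs2⟩, hs⟩ := intermediate_value_Icc hwB.le hc.continuousOn
    (show σ * (H p).1 ∈ _ from ⟨hqle, hwlt.le⟩)
  have hs3 := mul_left_cancel₀ hσ hs
  have hwV : w ∈ V := (hVH w).1 hqV
  have hsV : H (w.1, s) ∈ V := (hVH _).2 (hup w hwV s hs1)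
  rw [Metric.mem_ball, Prod.dist_eq, max_lt_iff, Subtype.dist_eq, Real.dist_eq, Real.dist_eq,
    abs_lt, abs_lt] at hw
  have hsball : (H (w.1, s)).2 < y₁ := by
    refine hball ?_
    rw [Metric.mem_ball, Prod.dist_eq, max_lt_iff, Subtype.dist_eq, Real.dist_eq, Real.dist_eq,
      abs_lt, abs_lt]
    have h1 : (w.2 : ℝ) ≤ s := hs1
    have h2 : (s : ℝ) ≤ B := hs2
    refine ⟨hw.1, ?_, ?_⟩ <;> simp only <;> linarith [hw.2.1]
  have := hup _ hsV y₁ hsball.le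
  rwa [hs3] at this

namespace AnnulusHomeo

variable {h : AnnulusHomeo}

lemma iter_natCast (h : AnnulusHomeo) (n : ℕ) : h.iter (n : ℤ) = h.toFun^[n] := by
  funext z
  simp only [iter, zpow_natCast, ← Equiv.Perm.iterate_eq_pow]
  rfl

/-- The region above an invariant connected set is invariant. -/
lemma IsTwist.apply_mem_upperRegion_iff (ht : h.IsTwist) (hnw : NonWandering h) {Y : Set Ann}
    (hYc : IsClosed Y) (hY : IsPreconnected Y) (hC0 : C0 ⊆ Y)
    (hinv : ∀ z, h.toFun z ∈ Y ↔ z ∈ Y) (z : Ann) :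
    h.toFun z ∈ upperRegion Y ↔ z ∈ upperRegion Y := by
  have hVo := isOpen_upperRegion hYc
  have hrec : ∀ P : Set Ann, IsOpen P → P.Nonempty → P ⊆ upperRegion Y →
      ∃ p ∈ P, ∃ k, 0 < k ∧ h.toFun^[k] p ∈ P ∧
        ∀ j ≤ k, h.toFun^[j] p ∈ upperRegion Y := by
    intro P hP hne hPV
    obtain ⟨k, hk, w, ⟨p, hp, rfl⟩, hw⟩ := hnw P hP hne
    rw [iter_natCast] at hw
    exact ⟨p, hp, k, hk, hw, fun j hj =>
      ht.iterate_mem_upperRegion hYc hY hC0 hinv (hPV hp) (hPV hw) hj⟩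
  constructor
  · have hsub : h.toFun ⁻¹' upperRegion Y ⊆ upperRegion Y := by
      refine subset_upperRegion_of_subset_closure hYc hY hC0 (hVo.preimage h.toFun.continuous)
        (fun w hw hwY => upperRegion_subset_compl Y hw ((hinv w).2 hwY)) ?_
      intro w hw
      rw [mem_closure_iff]
      intro O hO hwO
      obtain ⟨p, hp, k, hk, hkp, hj⟩ := hrec (upperRegion Y ∩ h.toFun.symm ⁻¹' O)
        (hVo.inter (hO.preimage h.toFun.symm.continuous)) ⟨h.toFun w, hw, by simpa using hwO⟩
        Set.inter_subset_left
      obtain ⟨k, rfl⟩ := Nat.exists_eq_succ_of_ne_zero hk.ne'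
      refine ⟨h.toFun^[k] p, ?_, hj k (Nat.le_succ k)⟩
      have := hkp.2
      rwa [Function.iterate_succ_apply', Set.mem_preimage, h.toFun.symm_apply_apply] at this
    exact fun hz => hsub hz
  · have hsub : h.toFun.symm ⁻¹' upperRegion Y ⊆ upperRegion Y := by
      refine subset_upperRegion_of_subset_closure hYc hY hC0 (hVo.preimage h.toFun.symm.continuous)
        (fun w hw hwY => upperRegion_subset_compl Y hw
          ((hinv _).1 (by rwa [h.toFun.apply_symm_apply]))) ?_
      intro w hw
      rw [mem_closure_iff]
      intro O hO hwO
      obtain ⟨p, hp, k, hk, hkp, hj⟩ := hrec (upperRegion Y ∩ h.toFun ⁻¹' O)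
        (hVo.inter (hO.preimage h.toFun.continuous))
        ⟨h.toFun.symm w, hw, by simpa using hwO⟩ Set.inter_subset_left
      exact ⟨h.toFun p, hp.2, hj 1 hk⟩
    intro hz
    exact hsub (by simpa using hz)

lemma IsTwist.mem_upperRegion_of_mem_closure (ht : h.IsTwist) {Y : Set Ann}
    (hVinv : ∀ z, h.toFun z ∈ upperRegion Y ↔ z ∈ upperRegion Y) {z : Ann}
    (hz : z ∈ closure (upperRegion Y)) {y : ↥(Set.Icc (0:ℝ) 1)} (hy : z.2 < y) :
    (z.1, y) ∈ upperRegion Y := by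
  obtain ⟨z, rfl⟩ := surjective_annProj z
  set V := annProj ⁻¹' upperRegion Y with hV
  have hup : ∀ z ∈ V, ∀ y, z.2 ≤ y → (z.1, y) ∈ V := fun z hz y hy =>
    upperRegion_up (z := annProj z) hz hy
  have hVL : ∀ z, h.lift z ∈ V ↔ z ∈ V := fun z => by
    rw [hV, Set.mem_preimage, h.lift_proj, hVinv, Set.mem_preimage]
  have hcl : z ∈ closure V := by
    rw [hV, ← isOpenMap_annProj.preimage_closure_eq_closure_preimage continuous_annProj]
    exact hz
  have hfr : ∃ᶠ q in 𝓝 z, (q ∈ V ∧ 1 * q.1 ≤ 1 * z.1) ∨ (q ∈ V ∧ (-1) * q.1 ≤ (-1) * z.1) := by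
    refine (mem_closure_iff_frequently.1 hcl).mono fun q hq => ?_
    rcases le_total q.1 z.1 with h1 | h1
    · exact Or.inl ⟨hq, by linarith⟩
    · exact Or.inr ⟨hq, by linarith⟩
  show (z.1, y) ∈ V
  rcases Filter.frequently_or_distrib.1 hfr with h1 | h1
  · refine mem_of_frequently_mem_side h.lift one_ne_zero (fun x => ?_) ht.lift_snd_eq_one_iff
      hup hVL hy h1
    simpa only [one_mul] using ht x
  · refine mem_of_frequently_mem_side h.lift.symm (neg_ne_zero.2 one_ne_zero) (fun x => ?_)
      (fun z => ?_) hup (fun z => ?_) hy h1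
    · simpa only [neg_one_mul] using (ht.strictAnti_symm x).neg
    · rw [← ht.lift_snd_eq_one_iff, h.lift.apply_symm_apply]
    · rw [← hVL, h.lift.apply_symm_apply]

/-- Without invariant transverse loop, an invariant continuum containing `C0` either is `C0` or
contains `C1`. -/
lemma IsTwist.subset_C0_or_C1_subset (ht : h.IsTwist) (hnw : NonWandering h)
    (hNoLoop : NoInvariantTransverseLoop h) {Y : Set Ann}
    (hYc : IsClosed Y) (hY : IsPreconnected Y) (hC0 : C0 ⊆ Y)
    (hinv : ∀ z, h.toFun z ∈ Y ↔ z ∈ Y) : Y ⊆ C0 ∨ C1 ⊆ Y := by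
  have hVinv := ht.apply_mem_upperRegion_iff hnw hYc hY hC0 hinv
  have hVo := isOpen_upperRegion hYc
  set V := upperRegion Y with hV
  set Γ : Set Ann := {z | z ∉ V ∧ (z ∈ closure V ∨ z.2 = 1)} with hΓ
  have hΓc : IsClosed Γ := hVo.isClosed_compl.inter
    (isClosed_closure.union (isClosed_eq continuous_snd continuous_const))
  have hcl : ∀ z, h.toFun z ∈ closure V ↔ z ∈ closure V := by
    intro z
    have e : h.toFun ⁻¹' V = V := Set.ext hVinv
    rw [← Set.mem_preimage, h.toFun.preimage_closure, e]
  have htop : ∀ z, (h.toFun z).2 = 1 ↔ z.2 = 1 := by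
    intro z
    obtain ⟨z, rfl⟩ := surjective_annProj z
    rw [← h.lift_proj]
    exact ht.lift_snd_eq_one_iff z
  have hΓinv : h.toFun '' Γ = Γ := by
    have hpre : h.toFun ⁻¹' Γ = Γ := by
      ext z
      simp only [hΓ, Set.mem_preimage, Set.mem_ofPred_eq, hVinv, hcl, htop]
    conv_lhs => rw [← hpre]
    exact h.toFun.surjective.image_preimage Γ
  have habove : ∀ z ∈ Γ, ∀ y, z.2 < y → (z.1, y) ∈ V := by
    rintro z ⟨-, hz | hz⟩ y hy
    · exact ht.mem_upperRegion_of_mem_closure hVinv hz hy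
    · rw [hz] at hy
      exact absurd hy (not_lt.2 y.2.2)
  have hΓY : Γ ⊆ Y := by
    intro z hz
    have h1 := hz.1
    simp only [hV, upperRegion, Set.mem_ofPred_eq, not_forall, not_not] at h1
    obtain ⟨y, hy, hyY⟩ := h1
    rcases hy.eq_or_lt with h2 | h2
    · rwa [← h2] at hyY
    · exact absurd hyY (upperRegion_subset_compl Y (habove z hz y h2))
  have hΓv : MeetsVerticalsOnce Γ := by
    intro x
    have hKc : IsCompact {y : ↥(Set.Icc (0:ℝ) 1) | (x, y) ∉ V} :=
      (hVo.isClosed_compl.preimage (by fun_prop : Continuous fun y => (x, y))).isCompact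
    obtain ⟨m, hm, hmax⟩ := hKc.exists_isGreatest
      ⟨0, fun h0 => upperRegion_subset_compl Y h0 (hC0 rfl)⟩
    refine ⟨(x, m), ⟨⟨hm, ?_⟩, rfl⟩, ?_⟩
    · by_cases hm1 : m = 1
      · exact Or.inr hm1
      · left
        have hlt : m < 1 := lt_of_le_of_ne m.2.2 hm1
        have hmc : m ∈ closure (Set.Ioi m) := by
          rw [closure_Ioi' (a := m) (show (Set.Ioi m).Nonempty from ⟨1, hlt⟩)]
          exact Set.self_mem_Ici
        refine map_mem_closure (by fun_prop : Continuous fun y => (x, y)) hmc fun y hy => ?_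
        by_contra hyV
        exact absurd (hmax hyV) (not_le.2 hy)
    · rintro ⟨x', y⟩ ⟨hyΓ, rfl⟩
      refine Prod.ext rfl (le_antisymm (hmax hyΓ.1) ?_)
      by_contra! hlt
      exact hm (habove _ hyΓ m hlt)
  rcases hNoLoop Γ (isEssentialSimpleLoop_of_meetsVerticalsOnce hΓc hΓv) hΓv hΓinv with h1 | h1
  · left
    intro z hz
    obtain ⟨w, ⟨hwΓ, hwz⟩, -⟩ := hΓv z.1
    have hw0 : w ∈ C0 := h1 ▸ hwΓ
    by_contra hne
    have hlt : w.2 < z.2 := by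
      have h2 : (w.2 : ℝ) = 0 := hw0
      rw [← Subtype.coe_lt_coe, h2]
      exact lt_of_le_of_ne z.2.2.1 (Ne.symm hne)
    have h3 := habove w hwΓ z.2 hlt
    rw [hwz] at h3
    exact upperRegion_subset_compl Y h3 hz
  · right
    rw [← h1]
    exact hΓY

end AnnulusHomeo

lemma isPreconnected_iInter_of_antitone {X : Type*} [TopologicalSpace X] [T2Space X]
    {K : ℕ → Set X} (hK : Antitone K) (hc : ∀ n, IsCompact (K n)) (hp : ∀ n, IsPreconnected (K n)) :
    IsPreconnected (⋂ n, K n) := by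
  rw [isPreconnected_iff_subset_of_disjoint_closed]
  intro u v hu hv huv hd
  have hI : IsCompact (⋂ n, K n) :=
    (hc 0).of_isClosed_subset (isClosed_iInter fun n => (hc n).isClosed) (Set.iInter_subset K 0)
  have hdisj : Disjoint ((⋂ n, K n) ∩ u) ((⋂ n, K n) ∩ v) := by
    rw [Set.disjoint_iff_inter_eq_empty, ← Set.inter_inter_distrib_left, hd]
  obtain ⟨U, V, hU, hV, hsU, hsV, hUV⟩ :=
    SeparatedNhds.of_isCompact_isCompact (hI.inter_right hu) (hI.inter_right hv) hdisj
  obtain ⟨n, hn⟩ := exists_subset_nhds_of_isCompact' (U := U ∪ V) hK.directed_ge hc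
    (fun n => (hc n).isClosed) fun x hx => (hU.union hV).mem_nhds <|
      (huv hx).imp (fun h => hsU ⟨hx, h⟩) fun h => hsV ⟨hx, h⟩
  rcases isPreconnected_iff_subset_of_disjoint.1 (hp n) U V hU hV hn
    (by rw [hUV.inter_eq, Set.inter_empty]) with h | h
  · left
    intro x hx
    exact (huv hx).resolve_right fun hxv =>
      Set.disjoint_left.1 hUV (h (Set.iInter_subset K n hx)) (hsV ⟨hx, hxv⟩)
  · right
    intro x hx
    exact (huv hx).resolve_left fun hxu =>
      Set.disjoint_left.1 hUV (hsU ⟨hx, hxu⟩) (h (Set.iInter_subset K n hx))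

lemma PositiveTwistMap.isTwist (f : PositiveTwistMap) : f.toAnnulusHomeo.IsTwist := by
  intro x y₁ y₂ hy
  have hd : ∀ y ∈ Set.Icc (0:ℝ) 1,
      HasDerivWithinAt (fun y => (f.F (x, y)).1) (f.F' (x, y) (0, 1)).1 (Set.Icc 0 1) y := by
    intro y hy
    have h1 : HasDerivWithinAt (fun y : ℝ => (x, y)) ((0 : ℝ), (1 : ℝ)) (Set.Icc 0 1) y :=
      (hasDerivWithinAt_const y _ x).prodMk (hasDerivWithinAt_id y _)
    have h2 := (f.F_hasDeriv (x, y) hy).comp_hasDerivWithinAt y h1 (fun t ht => ht)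
    exact hasFDerivAt_fst.comp_hasDerivWithinAt y h2
  have hmono : StrictMonoOn (fun y => (f.F (x, y)).1) (Set.Icc (0:ℝ) 1) :=
    strictMonoOn_of_hasDerivWithinAt_pos (convex_Icc 0 1)
      (fun y hy => (hd y hy).continuousWithinAt)
      (fun y hy => (hd y (interior_subset hy)).mono interior_subset)
      fun y hy => f.twist_pos (x, y) (show y ∈ Set.Icc 0 1 from interior_subset hy)
  simpa only [f.F_lift (x, y₁), f.F_lift (x, y₂)] using hmono y₁.2 y₂.2 hy

/-- The bottom boundary circle is forward invariant. -/
lemma AnnulusHomeo.iterate_mem_C0 (h : AnnulusHomeo) {z : Ann} (hz : z ∈ C0) (n : ℕ) :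
    h.toFun^[n] z ∈ C0 := by
  have hm : Set.MapsTo h.toFun C0 C0 := by
    intro w hw
    obtain ⟨w, rfl⟩ := surjective_annProj w
    rw [← h.lift_proj]
    exact h.lift_bd0 w hw
  exact hm.iterate n hz

/-- For a non wandering positive twist map with no invariant transverse essential loop
except `C₀` and `C₁`: a backward invariant continuum strictly containing `C₀` and
disjoint from `C₁` shrinks to `C₀` under backward iteration, and its forward iterates
accumulate on `C₁`. -/
theorem statement9 (f : PositiveTwistMap) (hnw : NonWandering f.toAnnulusHomeo)
    (hNoLoop : NoInvariantTransverseLoop f.toAnnulusHomeo)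
    (X₀ : Set Ann) (hX₀ : IsContinuum X₀) (hback : X₀ ⊆ f.toFun '' X₀)
    (hC0 : C0 ⊂ X₀) (hC1 : X₀ ∩ C1 = ∅) :
    (⋂ n : ℕ, f.toAnnulusHomeo.iter (n : ℤ) ⁻¹' X₀) = C0 ∧
      C1 ⊆ closure (⋃ n : ℕ, f.toAnnulusHomeo.iter (n : ℤ) '' X₀) := by
  simp only [f.iter_natCast]
  set g := f.toFun with hg
  have ht := f.isTwist
  obtain ⟨-, hXc, hXp⟩ := hX₀
  have hgn : ∀ n, Continuous g^[n] := fun n => g.continuous.iterate n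
  have hpre : ∀ z, g z ∈ X₀ → z ∈ X₀ := by
    intro z hz
    obtain ⟨w, hw, hwz⟩ := hback hz
    rwa [← g.injective hwz]
  have hC1X : ¬ C1 ⊆ X₀ := fun hsub => by
    have h1 : ((0 : 𝕋), (1 : ↥(Set.Icc (0:ℝ) 1))) ∈ C1 := rfl
    have : ((0 : 𝕋), (1 : ↥(Set.Icc (0:ℝ) 1))) ∈ X₀ ∩ C1 := ⟨hsub h1, h1⟩
    rwa [hC1] at this
  constructor
  · set K : ℕ → Set Ann := fun n => g^[n] ⁻¹' X₀ with hK
    have hanti : Antitone K := antitone_nat_of_succ_le fun n z hz => by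
      have hz' : g^[n + 1] z ∈ X₀ := hz
      rw [Function.iterate_succ_apply'] at hz'
      exact hpre _ hz'
    have hKc : ∀ n, IsClosed (K n) := fun n => hXc.isClosed.preimage (hgn n)
    have hKp : ∀ n, IsPreconnected (K n) := by
      intro n
      induction n with
      | zero => exact hXp
      | succ n ih =>
        have : K (n + 1) = g ⁻¹' K n := by
          rw [hK]
          simp only [Function.iterate_succ, Set.preimage_comp]
        rw [this]
        exact g.isPreconnected_preimage.2 ih
    have hsub : C0 ⊆ ⋂ n, K n := fun z hz =>
      Set.mem_iInter.2 fun n => hC0.1 (f.iterate_mem_C0 hz n)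
    have hinv : ∀ z, g z ∈ ⋂ n, K n ↔ z ∈ ⋂ n, K n := by
      intro z
      simp only [Set.mem_iInter]
      refine ⟨fun h n => hanti n.le_succ (h n), fun h n => h (n + 1)⟩
    refine Set.Subset.antisymm ?_ hsub
    refine (ht.subset_C0_or_C1_subset hnw hNoLoop (isClosed_iInter hKc)
      (isPreconnected_iInter_of_antitone hanti (fun n => (hKc n).isCompact) hKp) hsub
      hinv).resolve_right fun h1 => hC1X (h1.trans (Set.iInter_subset K 0))
  · set L : ℕ → Set Ann := fun n => g^[n] '' X₀ with hL
    have hL0 : L 0 = X₀ := Set.image_id X₀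
    have hLs : ∀ n, L (n + 1) = g '' L n := fun n => by
      simp only [hL, Function.iterate_succ', Set.image_comp]
    have hmono : Monotone L := monotone_nat_of_le_succ fun n => by
      simp only [hL, Function.iterate_succ, Set.image_comp]
      exact Set.image_mono hback
    have hXL : X₀ ⊆ ⋃ n, L n := hL0 ▸ Set.subset_iUnion L 0
    have hLp : IsPreconnected (⋃ n, L n) := by
      obtain ⟨x, hx⟩ : C0.Nonempty := ⟨((0 : 𝕋), 0), rfl⟩
      exact isPreconnected_iUnion ⟨x, Set.mem_iInter.2 fun n => hmono n.zero_le
        (hL0.symm ▸ hC0.1 hx)⟩ fun n => hXp.image _ (hgn n).continuousOn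
    have himg : g '' closure (⋃ n, L n) = closure (⋃ n, L n) := by
      rw [g.image_closure, Set.image_iUnion]
      simp only [← hLs]
      rw [hmono.iUnion_nat_add 1]
    have hinv : ∀ z, g z ∈ closure (⋃ n, L n) ↔ z ∈ closure (⋃ n, L n) := fun z => by
      conv_lhs => rw [← himg]
      exact g.injective.mem_set_image
    refine (ht.subset_C0_or_C1_subset hnw hNoLoop isClosed_closure hLp.closure
      (hC0.1.trans (hXL.trans subset_closure)) hinv).resolve_left fun h0 =>
        hC0.2 ((hXL.trans subset_closure).trans h0)
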